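/- arXiv:2405.16276 — 2 statements merged into one kernel-verified Lean document; each statement's English description precedes it below -/
import Mathlib

section
/- In the RLHF Game with a SW-Max training rule ψ and zero payments, under summation normalization of reward models, suppose f is α-strongly convex for some α > 0 and twice continuously differentiable on (0,∞), and for every profile the SW-Max maximizer has full support. Fix a truthful profile (r⃗, w⃗, π₀), let π = ψ(r⃗, w⃗, π₀), and define t(z) = Σ_{x∈X} (r_i(z) − r_i(x)) · π₀(x) / f''(π(x)/π₀(x)). Suppose group i's reward model takes at least two distinct values on X (s_i ≥ 2) and min_{x∈X} r_i(x) = 0. If there exists x₁ ∈ X with t(x₁) < 0 and 0 < r_i(x₁) < 1, then truthful reporting is not optimal for group i: there exists a summation-normalized reward model r'_i with v(ψ((r'_i, r⃗_{-i}), w⃗, π₀); r_i) > v(ψ(r⃗, w⃗, π₀); r_i). -/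
open Finset

noncomputable section

variable {X : Type*}

/-- A model is a probability distribution on the finite outcome set `X`. -/
def IsModel [Fintype X] (π : X → ℝ) : Prop :=
  (∀ x, 0 ≤ π x) ∧ ∑ x, π x = 1

/-- A function on `X` has full support if it is everywhere positive. -/
def FullSupport (π : X → ℝ) : Prop :=
  ∀ x, 0 < π x

/-- A reward model normalized by summation. -/
def IsRewardSum [Fintype X] (r : X → ℝ) : Prop :=
  (∀ x, 0 ≤ r x) ∧ ∑ x, r x = 1

/-- A reward model normalized by maximum. -/
def IsRewardMax (r : X → ℝ) : Prop :=
  (∀ x, 0 ≤ r x) ∧ (∀ x, r x ≤ 1) ∧ ∃ x, r x = 1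

/-- The valuation of a model `π` under a reward model `r`. -/
def valuation [Fintype X] (π r : X → ℝ) : ℝ :=
  ∑ x, π x * r x

/-- The `f`-divergence between `π` and `π₀`. -/
def fDiv [Fintype X] (f : ℝ → ℝ) (π π₀ : X → ℝ) : ℝ :=
  ∑ x, π₀ x * f (π x / π₀ x)

/-- The affine social welfare. -/
def ASW [Fintype X] (f : ℝ → ℝ) {n : ℕ} (r : Fin n → X → ℝ) (w : Fin n → ℕ)
    (π π₀ : X → ℝ) : ℝ :=
  (∑ i, (w i : ℝ) * valuation π (r i)) - fDiv f π π₀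

/-- A SW-Max training rule: on every profile of reward models in the domain `Rdom`
and every full-support initial model, it outputs a model maximizing the affine social
welfare.  Weight vectors range over all of `ℕ` so that the rule is also defined on
profiles with a group removed (encoded by a zero weight). -/
def SWMaxRule [Fintype X] (f : ℝ → ℝ) (Rdom : (X → ℝ) → Prop) {n : ℕ}
    (ψ : (Fin n → X → ℝ) → (Fin n → ℕ) → (X → ℝ) → (X → ℝ)) : Prop :=
  ∀ (r : Fin n → X → ℝ) (w : Fin n → ℕ) (π₀ : X → ℝ),
    (∀ j, Rdom (r j)) → IsModel π₀ → FullSupport π₀ →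
      IsModel (ψ r w π₀) ∧
      ∀ π : X → ℝ, IsModel π → ASW f r w π π₀ ≤ ASW f r w (ψ r w π₀) π₀

lemma ASW_eq_sum [Fintype X] (f : ℝ → ℝ) {n : ℕ} (r : Fin n → X → ℝ) (w : Fin n → ℕ)
    (π π₀ : X → ℝ) :
    ASW f r w π π₀ = ∑ z, (π z * ∑ j, (w j : ℝ) * r j z - π₀ z * f (π z / π₀ z)) := by
  simp only [ASW, valuation, fDiv, Finset.sum_sub_distrib, Finset.mul_sum]
  rw [Finset.sum_comm]
  congr 1
  exact Finset.sum_congr rfl fun _ _ => Finset.sum_congr rfl fun _ _ => by ring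

/-- First-order condition for a full-support maximizer of affine social welfare. -/
lemma exists_multiplier_of_ASW_max [Fintype X] [Nonempty X] {n : ℕ} {f f' : ℝ → ℝ}
    (hd : ∀ y ∈ Set.Ioi (0 : ℝ), HasDerivAt f (f' y) y)
    {r : Fin n → X → ℝ} {w : Fin n → ℕ} {π π₀ : X → ℝ} (hπ₀ : FullSupport π₀)
    (hπ : IsModel π) (hfull : FullSupport π)
    (hmax : ∀ ρ : X → ℝ, IsModel ρ → ASW f r w ρ π₀ ≤ ASW f r w π π₀) :
    ∃ c, ∀ z, f' (π z / π₀ z) = ∑ j, (w j : ℝ) * r j z - c := by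
  classical
  set G : X → ℝ := fun z => ∑ j, (w j : ℝ) * r j z
  have key : ∀ h : X → ℝ, ∑ z, h z = 0 → ∑ z, h z * (G z - f' (π z / π₀ z)) = 0 := by
    intro h hh
    have hder : HasDerivAt (fun s : ℝ => ASW f r w (fun z => π z + s * h z) π₀)
        (∑ z, h z * (G z - f' (π z / π₀ z))) 0 := by
      simp only [ASW_eq_sum]
      refine HasDerivAt.fun_sum fun z _ => ?_
      have hz := (hπ₀ z).ne'
      have h1 : HasDerivAt (fun s : ℝ => π z + s * h z) (h z) 0 := by
        simpa using ((hasDerivAt_id (0 : ℝ)).mul_const (h z)).const_add (π z)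
      have h2 : HasDerivAt f (f' (π z / π₀ z)) ((π z + 0 * h z) / π₀ z) := by
        simpa using hd _ (div_pos (hfull z) (hπ₀ z))
      have h3 := (h1.mul_const (G z)).sub
        ((h2.comp (0 : ℝ) (h1.div_const (π₀ z))).const_mul (π₀ z))
      refine h3.congr_deriv ?_
      field_simp
    have hloc : IsLocalMax (fun s : ℝ => ASW f r w (fun z => π z + s * h z) π₀) 0 := by
      have hev : ∀ᶠ s : ℝ in nhds 0, ∀ z, 0 < π z + s * h z := by
        refine Filter.eventually_all.2 fun z => ?_
        have hc : ContinuousAt (fun s : ℝ => π z + s * h z) 0 := by fun_prop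
        exact hc.eventually (lt_mem_nhds (by simpa using hfull z))
      filter_upwards [hev] with s hs
      simp only [zero_mul, add_zero]
      refine hmax _ ⟨fun z => (hs z).le, ?_⟩
      rw [Finset.sum_add_distrib, ← Finset.mul_sum, hh, hπ.2]
      ring
    exact hloc.hasDerivAt_eq_zero hder
  obtain ⟨x⟩ := ‹Nonempty X›
  refine ⟨G x - f' (π x / π₀ x), fun z => ?_⟩
  have := key (Pi.single x 1 - Pi.single z 1) (by simp)
  simp [sub_mul, Pi.single_apply] at this
  linarith

lemma le_dslope_of_le_deriv {g g' : ℝ → ℝ} {α a b : ℝ} (ha : 0 < a) (hb : 0 < b)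
    (hd : ∀ y ∈ Set.Ioi (0 : ℝ), HasDerivAt g (g' y) y)
    (hle : ∀ y ∈ Set.Ioi (0 : ℝ), α ≤ g' y) : α ≤ dslope g a b := by
  rcases eq_or_ne b a with rfl | hne
  · rw [dslope_same, (hd b hb).deriv]
    exact hle b hb
  have main : ∀ u v : ℝ, 0 < u → u < v → α ≤ slope g u v := by
    intro u v hu huv
    obtain ⟨c, hc, hcs⟩ := exists_hasDerivAt_eq_slope g g' huv
      (fun y hy => (hd y (hu.trans_le hy.1)).continuousAt.continuousWithinAt)
      (fun y hy => hd y (hu.trans hy.1))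
    rw [slope_def_field, ← hcs]
    exact hle c (hu.trans hc.1)
  rw [dslope_of_ne _ hne]
  rcases hne.lt_or_gt with h | h
  · rw [slope_comm]
    exact main b a hb h
  · exact main a b ha h

/-- Weighted first-order response of the valuation under `r` to a change `h` in reward. -/
def weightedResponse [Fintype X] (h r b : X → ℝ) : ℝ :=
  ∑ z, h z * b z * (r z * ∑ x, b x - ∑ x, b x * r x)

lemma sum_mul_sum_eq_weightedResponse [Fintype X] {h r b : X → ℝ} {k c : ℝ}
    (hsum : ∑ z, b z * (k * h z - c) = 0) :
    (∑ z, b z) * ∑ z, b z * (k * h z - c) * r z = k * weightedResponse h r b := by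
  have e1 : k * ∑ z, b z * h z = c * ∑ z, b z := by
    rw [Finset.mul_sum, Finset.mul_sum, ← sub_eq_zero, ← Finset.sum_sub_distrib, ← hsum]
    exact Finset.sum_congr rfl fun _ _ => by ring
  have e2 : ∑ z, b z * (k * h z - c) * r z
      = k * ∑ z, b z * h z * r z - c * ∑ z, b z * r z := by
    rw [Finset.mul_sum, Finset.mul_sum, ← Finset.sum_sub_distrib]
    exact Finset.sum_congr rfl fun _ _ => by ring
  have e3 : weightedResponse h r b = (∑ z, b z * h z * r z) * (∑ z, b z)
      - (∑ z, b z * h z) * ∑ z, b z * r z := by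
    rw [weightedResponse, Finset.sum_mul, Finset.sum_mul, ← Finset.sum_sub_distrib]
    exact Finset.sum_congr rfl fun _ _ => by ring
  rw [e2, e3]
  linear_combination (∑ z, b z * r z) * e1

lemma abs_le_of_sum_mul_sub_eq_zero [Fintype X] [Nonempty X] {h b : X → ℝ} {k c : ℝ}
    (hk : 0 ≤ k) (hb : ∀ z, 0 < b z) (hh : ∀ z, |h z| ≤ 1)
    (hsum : ∑ z, b z * (k * h z - c) = 0) : |c| ≤ k := by
  by_contra! hc
  have hkh : ∀ z, |k * h z| ≤ k := fun z => by
    rw [abs_mul, abs_of_nonneg hk]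
    exact mul_le_of_le_one_right hk (hh z)
  rcases lt_abs.1 hc with h1 | h1
  · refine (Finset.sum_neg (fun z _ => ?_) Finset.univ_nonempty).ne hsum
    exact mul_neg_of_pos_of_neg (hb z) (by linarith [(abs_le.1 (hkh z)).2])
  · refine (Finset.sum_pos (fun z _ => ?_) Finset.univ_nonempty).ne' hsum
    exact mul_pos (hb z) (by linarith [(abs_le.1 (hkh z)).1])

/-- summation normalization, `f` α-strongly convex and C².  If
`s_i ≥ 2`, `min r_i = 0`, and there is `x₁` with `t x₁ < 0` and `0 < r_i x₁ < 1`,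
then truthful reporting is not optimal for group `i`. -/
theorem swmax_sum_norm_t_neg_not_optimal
    [Fintype X] [Nonempty X] {n : ℕ} (f f' f'' : ℝ → ℝ) (α : ℝ) (hα : 0 < α)
    (hconv : ConvexOn ℝ (Set.Ioi 0) f) (hf1 : f 1 = 0)
    (hd1 : ∀ y ∈ Set.Ioi (0 : ℝ), HasDerivAt f (f' y) y)
    (hd2 : ∀ y ∈ Set.Ioi (0 : ℝ), HasDerivAt f' (f'' y) y)
    (hc2 : ContinuousOn f'' (Set.Ioi 0))
    (hstrong : ∀ y ∈ Set.Ioi (0 : ℝ), α ≤ f'' y)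
    (ψ : (Fin n → X → ℝ) → (Fin n → ℕ) → (X → ℝ) → (X → ℝ))
    (hψ : SWMaxRule f (IsRewardSum (X := X)) ψ)
    (hfull : ∀ (r : Fin n → X → ℝ) (w : Fin n → ℕ) (π₀ : X → ℝ),
      (∀ j, IsRewardSum (r j)) → IsModel π₀ → FullSupport π₀ →
      FullSupport (ψ r w π₀))
    (i : Fin n) (r : Fin n → X → ℝ) (w : Fin n → ℕ) (π₀ : X → ℝ)
    (hr : ∀ j, IsRewardSum (r j)) (hw : ∀ j, 1 ≤ w j)
    (hπ₀ : IsModel π₀) (hfs : FullSupport π₀)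
    (hs : ∃ x y, r i x ≠ r i y)
    (hmin : ∃ x, r i x = 0)
    (hx₁ : ∃ x₁ : X,
      (∑ x, (r i x₁ - r i x) * π₀ x / f'' (ψ r w π₀ x / π₀ x)) < 0 ∧
      0 < r i x₁ ∧ r i x₁ < 1) :
    ∃ r' : X → ℝ, IsRewardSum r' ∧
      valuation (ψ (Function.update r i r') w π₀) (r i) >
        valuation (ψ r w π₀) (r i) := by
  classical
  obtain ⟨x₁, ht₁, hpos₁, -⟩ := hx₁
  obtain ⟨hp, hpmax⟩ := hψ r w π₀ hr hπ₀ hfs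
  have hpf := hfull r w π₀ hr hπ₀ hfs
  set p := ψ r w π₀
  have hy : ∀ z, 0 < p z / π₀ z := fun z => div_pos (hpf z) (hfs z)
  set a : X → ℝ := fun z => π₀ z / f'' (p z / π₀ z) with ha
  have hapos : ∀ z, 0 < a z := fun z => div_pos (hfs z) (hα.trans_le (hstrong _ (hy z)))
  set t : X → ℝ := fun z => r i z * ∑ x, a x - ∑ x, a x * r i x with ht
  have ht₁' : t x₁ < 0 := by
    convert ht₁ using 1
    simp only [ht, ha]
    rw [Finset.mul_sum, ← Finset.sum_sub_distrib]
    exact Finset.sum_congr rfl fun _ _ => by ring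
  obtain ⟨x₂, ht₂⟩ : ∃ x₂, 0 < t x₂ := by
    by_contra! hle
    have hsum : ∑ z, a z * t z = 0 := by
      simp only [ht, mul_sub, Finset.sum_sub_distrib, ← mul_assoc, ← Finset.sum_mul]
      ring
    exact (Finset.sum_neg' (fun z _ => mul_nonpos_of_nonneg_of_nonpos (hapos z).le (hle z))
      ⟨x₁, Finset.mem_univ _, mul_neg_of_pos_of_neg (hapos x₁) ht₁'⟩).ne hsum
  have hne : x₁ ≠ x₂ := by
    rintro rfl
    linarith
  set h : X → ℝ := Pi.single x₂ 1 - Pi.single x₁ 1 with hh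
  have hh0 : ∑ z, h z = 0 := by simp [hh]
  have hhabs : ∀ z, |h z| ≤ 1 := fun z => by
    simp only [hh, Pi.sub_apply, Pi.single_apply]
    split_ifs <;> simp
  have hresp : 0 < weightedResponse h (r i) a := by
    have e : weightedResponse h (r i) a = a x₂ * t x₂ - a x₁ * t x₁ := by
      simp [weightedResponse, hh, ht, Pi.single_apply, sub_mul]
    rw [e]
    linarith [mul_pos (hapos x₂) ht₂, mul_neg_of_pos_of_neg (hapos x₁) ht₁']
  have hwi : (0 : ℝ) < w i := by exact_mod_cast hw i
  set r' : ℝ → X → ℝ := fun ε z => r i z + ε * h z with hr'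
  have hr'sum : ∀ ε ∈ Set.Ioc 0 (r i x₁), IsRewardSum (r' ε) := by
    rintro ε ⟨hε0, hε⟩
    refine ⟨fun z => ?_, ?_⟩
    · by_cases hz : z = x₁
      · subst hz
        simp [hr', hh, hne, hε]
      · have : 0 ≤ h z := by
          simp only [hh, Pi.sub_apply, Pi.single_apply, hz, if_false]
          split_ifs <;> simp
        exact add_nonneg ((hr i).1 z) (mul_nonneg hε0.le this)
    · simp only [hr']
      rw [Finset.sum_add_distrib, ← Finset.mul_sum, hh0, (hr i).2]
      ring
  set q : ℝ → X → ℝ := fun ε => ψ (Function.update r i (r' ε)) w π₀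
  set b : ℝ → X → ℝ := fun ε z => π₀ z / dslope f' (p z / π₀ z) (q ε z / π₀ z) with hb
  obtain ⟨c₀, hc₀⟩ := exists_multiplier_of_ASW_max hd1 hfs hp hpf hpmax
  have hshift : ∀ ε ∈ Set.Ioc 0 (r i x₁), IsModel (q ε) ∧
      (∀ z, 0 < b ε z ∧ b ε z ≤ π₀ z / α) ∧
      ∃ c, ∀ z, q ε z - p z = b ε z * ((w i * ε) * h z - c) := by
    intro ε hε
    have hru : ∀ j, IsRewardSum (Function.update r i (r' ε) j) := fun j => by
      rcases eq_or_ne j i with rfl | hj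
      · simpa using hr'sum ε hε
      · simpa [hj] using hr j
    obtain ⟨hqm, hqmax⟩ := hψ _ w π₀ hru hπ₀ hfs
    have hqf := hfull _ w π₀ hru hπ₀ hfs
    have hslope : ∀ z, α ≤ dslope f' (p z / π₀ z) (q ε z / π₀ z) := fun z =>
      le_dslope_of_le_deriv (hy z) (div_pos (hqf z) (hfs z)) hd2 hstrong
    obtain ⟨c₁, hc₁⟩ := exists_multiplier_of_ASW_max hd1 hfs hqm hqf hqmax
    refine ⟨hqm, fun z => ⟨div_pos (hfs z) (hα.trans_le (hslope z)),
      div_le_div_of_nonneg_left (hfs z).le hα (hslope z)⟩, c₁ - c₀, fun z => ?_⟩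
    have hG : ∑ j, (w j : ℝ) * Function.update r i (r' ε) j z
        = ∑ j, (w j : ℝ) * r j z + w i * ε * h z := by
      rw [← sub_eq_iff_eq_add', ← Finset.sum_sub_distrib, Finset.sum_eq_single i]
      · simp only [Function.update_self, hr']
        ring
      · intro j _ hj
        simp [hj]
      · simp
    have hs := sub_smul_dslope f' (p z / π₀ z) (q ε z / π₀ z)
    have hcz := hc₁ z
    rw [hG] at hcz
    change f' (q ε z / π₀ z) = _ at hcz
    rw [hcz, hc₀ z, smul_eq_mul] at hs
    have hD := (hα.trans_le (hslope z)).ne'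
    have hz := (hfs z).ne'
    have hs' : w i * ε * h z - (c₁ - c₀) =
        (q ε z / π₀ z - p z / π₀ z) * dslope f' (p z / π₀ z) (q ε z / π₀ z) := by
      rw [hs]
      ring
    rw [hs']
    simp only [hb]
    generalize dslope f' (p z / π₀ z) (q ε z / π₀ z) = D at hD ⊢
    field_simp
  have hsum0 : ∀ ε ∈ Set.Ioc 0 (r i x₁), ∀ c,
      (∀ z, q ε z - p z = b ε z * ((w i * ε) * h z - c)) →
      ∑ z, b ε z * ((w i * ε) * h z - c) = 0 := by
    intro ε hε c hc
    rw [← Finset.sum_congr rfl fun z _ => hc z, Finset.sum_sub_distrib, (hshift ε hε).1.2, hp.2,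
      sub_self]
  have hmem : ∀ᶠ ε : ℝ in nhdsWithin 0 (Set.Ioi 0), ε ∈ Set.Ioc 0 (r i x₁) :=
    Ioc_mem_nhdsGT hpos₁
  have hqlim : ∀ z, Filter.Tendsto (fun ε => q ε z) (nhdsWithin 0 (Set.Ioi 0)) (nhds (p z)) := by
    intro z
    have hlim : Filter.Tendsto (fun ε : ℝ => π₀ z / α * (2 * (w i * ε)))
        (nhdsWithin 0 (Set.Ioi 0)) (nhds 0) := by
      have : Continuous fun ε : ℝ => π₀ z / α * (2 * (w i * ε)) := by fun_prop
      simpa using (this.tendsto 0).mono_left nhdsWithin_le_nhds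
    rw [tendsto_iff_norm_sub_tendsto_zero]
    refine squeeze_zero' (Filter.Eventually.of_forall fun _ => norm_nonneg _) ?_ hlim
    filter_upwards [hmem] with ε hε
    obtain ⟨-, hbz, c, hc⟩ := hshift ε hε
    have hk : 0 ≤ w i * ε := mul_nonneg hwi.le hε.1.le
    have hcabs := abs_le_of_sum_mul_sub_eq_zero hk (fun z => (hbz z).1) hhabs
      (hsum0 ε hε c hc)
    rw [hc z, Real.norm_eq_abs, abs_mul, abs_of_pos (hbz z).1]
    refine mul_le_mul (hbz z).2 ?_ (abs_nonneg _) (div_pos (hfs z) hα).le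
    refine (abs_sub _ _).trans ?_
    rw [abs_mul, abs_of_nonneg hk]
    linarith [mul_le_of_le_one_right hk (hhabs z)]
  have hblim : ∀ z, Filter.Tendsto (fun ε => b ε z) (nhdsWithin 0 (Set.Ioi 0)) (nhds (a z)) := by
    intro z
    have hcont : ContinuousAt (dslope f' (p z / π₀ z)) (p z / π₀ z) :=
      continuousAt_dslope_same.2 (hd2 _ (hy z)).differentiableAt
    have h1 := hcont.tendsto.comp ((hqlim z).div_const (π₀ z))
    rw [dslope_same, (hd2 _ (hy z)).deriv] at h1
    exact tendsto_const_nhds.div h1 (hα.trans_le (hstrong _ (hy z))).ne'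
  have hresplim : Filter.Tendsto (fun ε => weightedResponse h (r i) (b ε))
      (nhdsWithin 0 (Set.Ioi 0)) (nhds (weightedResponse h (r i) a)) := by
    have hc : Continuous (weightedResponse h (r i)) := by
      unfold weightedResponse
      fun_prop
    exact (hc.tendsto a).comp (tendsto_pi_nhds.2 hblim)
  obtain ⟨ε, hε, hεresp⟩ := (hmem.and (hresplim.eventually (lt_mem_nhds hresp))).exists
  refine ⟨r' ε, hr'sum ε hε, ?_⟩
  obtain ⟨-, hbz, c, hc⟩ := hshift ε hε
  have hid := sum_mul_sum_eq_weightedResponse (r := r i) (hsum0 ε hε c hc)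
  have hval : valuation (q ε) (r i) - valuation p (r i)
      = ∑ z, b ε z * ((w i * ε) * h z - c) * r i z := by
    simp only [valuation]
    rw [← Finset.sum_sub_distrib]
    exact Finset.sum_congr rfl fun z _ => by rw [← hc z]; ring
  rw [← hval] at hid
  have hB : 0 < ∑ z, b ε z := Finset.sum_pos (fun z _ => (hbz z).1) Finset.univ_nonempty
  have hpos := mul_pos (mul_pos hwi hε.1) hεresp
  rw [← hid] at hpos
  exact sub_pos.1 (pos_of_mul_pos_right hpos hB.le)
end
end

section
/- Let ψ be a continuous SW-Max training rule and let p be a payment rule implementing ψ in DSIC. If p is always non-negative, then for every group i, every profile (r⃗, w⃗) of reported reward models and sizes, and every full-support initial model π₀, p_i(r⃗, w⃗, π₀) ≥ p^AFF_i(r⃗, w⃗, π₀). -/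
open Finset

noncomputable section

variable {X : Type*}

/-- The affine social welfare excluding group `i`'s contribution. -/
def ASWminus [Fintype X] (f : ℝ → ℝ) {n : ℕ} (r : Fin n → X → ℝ) (w : Fin n → ℕ)
    (i : Fin n) (π π₀ : X → ℝ) : ℝ :=
  ASW f r w π π₀ - (w i : ℝ) * valuation π (r i)

/-- The affine maximizer payment.  The profile with group `i` removed is encoded by
setting group `i`'s weight to `0`. -/
def pAFF [Fintype X] (f : ℝ → ℝ) {n : ℕ}
    (ψ : (Fin n → X → ℝ) → (Fin n → ℕ) → (X → ℝ) → (X → ℝ))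
    (r : Fin n → X → ℝ) (w : Fin n → ℕ) (π₀ : X → ℝ) (i : Fin n) : ℝ :=
  ASWminus f r w i (ψ r (Function.update w i 0) π₀) π₀ -
    ASWminus f r w i (ψ r w π₀) π₀

/-- A payment rule `p` implements the training rule `ψ` in DSIC (on the domain where
reward models satisfy `Rdom` and sizes lie in `{1, …, wbar}`): truthful reporting
always yields utility at least that of any misreport, regardless of others' reports. -/
def DSICw [Fintype X] {n : ℕ} (Rdom : (X → ℝ) → Prop) (wbar : ℕ)
    (ψ : (Fin n → X → ℝ) → (Fin n → ℕ) → (X → ℝ) → (X → ℝ))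
    (p : (Fin n → X → ℝ) → (Fin n → ℕ) → (X → ℝ) → Fin n → ℝ) : Prop :=
  ∀ (r : Fin n → X → ℝ) (w : Fin n → ℕ) (i : Fin n) (r' : X → ℝ) (w' : ℕ)
    (π₀ : X → ℝ),
    (∀ j, Rdom (r j)) → (∀ j, 1 ≤ w j ∧ w j ≤ wbar) →
    Rdom r' → 1 ≤ w' → w' ≤ wbar →
    IsModel π₀ → FullSupport π₀ →
    (w i : ℝ) * valuation (ψ r w π₀) (r i) - p r w π₀ i ≥
      (w i : ℝ) *
          valuation (ψ (Function.update r i r') (Function.update w i w') π₀) (r i) -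
        p (Function.update r i r') (Function.update w i w') π₀ i

/-- Continuity of a training rule: if the weighted aggregate reward functions of two
profiles are uniformly close, then the corresponding trained models are uniformly
close. -/
def ContinuousRule [Fintype X] {n : ℕ}
    (ψ : (Fin n → X → ℝ) → (Fin n → ℕ) → (X → ℝ) → (X → ℝ)) : Prop :=
  ∀ ε : ℝ, 0 < ε → ∃ δ : ℝ, 0 < δ ∧
    ∀ (r r' : Fin n → X → ℝ) (w w' : Fin n → ℕ) (π₀ : X → ℝ),
      IsModel π₀ → FullSupport π₀ →
      (∀ x, |∑ i, (w i : ℝ) * r i x - ∑ i, (w' i : ℝ) * r' i x| ≤ δ) →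
      ∀ x, |ψ r w π₀ x - ψ r' w' π₀ x| ≤ ε

theorem valuation_add_smul [Fintype X] (π q d : X → ℝ) (a : ℝ) :
    valuation π (q + a • d) = valuation π q + a * valuation π d := by
  simp only [valuation, Finset.mul_sum, ← Finset.sum_add_distrib, Pi.add_apply, Pi.smul_apply,
    smul_eq_mul]
  exact Finset.sum_congr rfl fun x _ => by ring

theorem IsModel.valuation_const [Fintype X] {π : X → ℝ} (h : IsModel π) (c : ℝ) :
    valuation π (fun _ => c) = c := by
  simp [valuation, ← Finset.sum_mul, h.2]

/-- The welfare of a profile in which group `i` reports `q`, split into the contributions of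
the other groups and of group `i`. -/
theorem ASW_update [Fintype X] (f : ℝ → ℝ) {n : ℕ} (r : Fin n → X → ℝ) (w : Fin n → ℕ)
    (i : Fin n) (q π π₀ : X → ℝ) :
    ASW f (Function.update r i q) w π π₀ =
      ASWminus f r w i π π₀ + (w i : ℝ) * valuation π q := by
  have h : ∑ j ∈ Finset.univ.erase i, (w j : ℝ) * valuation π (Function.update r i q j) =
      ∑ j ∈ Finset.univ.erase i, (w j : ℝ) * valuation π (r j) :=
    Finset.sum_congr rfl fun j hj => by
      rw [Function.update_of_ne (Finset.ne_of_mem_erase hj)]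
  simp only [ASWminus, ASW]
  rw [← Finset.add_sum_erase _ _ (Finset.mem_univ i), h,
    ← Finset.add_sum_erase Finset.univ (fun j => (w j : ℝ) * valuation π (r j))
      (Finset.mem_univ i), Function.update_self]
  ring

/-- Both reward normalizations admit a constant reward model, and the segment from it to any
reward model stays in the domain. -/
theorem exists_const_reward_segment [Fintype X] [Nonempty X] {Rdom : (X → ℝ) → Prop}
    (hdom : Rdom = (IsRewardSum (X := X)) ∨ Rdom = (IsRewardMax (X := X))) :
    ∃ c : ℝ, ∀ q : X → ℝ, Rdom q → ∀ t : ℝ, 0 ≤ t → t ≤ 1 →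
      Rdom ((fun _ => c) + t • (q - fun _ => c)) := by
  rcases hdom with rfl | rfl
  · have hX : (0 : ℝ) < Fintype.card X := by exact_mod_cast Fintype.card_pos
    refine ⟨(Fintype.card X : ℝ)⁻¹, fun q hq t ht₀ ht₁ => ⟨fun x => ?_, ?_⟩⟩
    · simp only [Pi.add_apply, Pi.smul_apply, Pi.sub_apply, smul_eq_mul]
      nlinarith [mul_nonneg ht₀ (hq.1 x), mul_nonneg (sub_nonneg.2 ht₁) (inv_pos.2 hX).le]
    · simp only [Pi.add_apply, Pi.smul_apply, Pi.sub_apply, smul_eq_mul,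
        Finset.sum_add_distrib, ← Finset.mul_sum, Finset.sum_sub_distrib, hq.2]
      simp [hX.ne']
  · refine ⟨1, fun q ⟨hq₀, hq₁, x, hx⟩ t ht₀ ht₁ => ⟨fun y => ?_, fun y => ?_, x, ?_⟩⟩ <;>
      simp only [Pi.add_apply, Pi.smul_apply, Pi.sub_apply, smul_eq_mul]
    · nlinarith [mul_nonneg ht₀ (hq₀ y)]
    · nlinarith [mul_nonneg ht₀ (sub_nonneg.2 (hq₁ y))]
    · simp [hx]

/-- If every increment of `g` between points `s` and `t` of `[0, 1]` is at least
`-(t - s) * (h t - h s)`, then `g 0 ≤ g 1`. -/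
theorem le_of_increment_ge {g h : ℝ → ℝ}
    (H : ∀ s t : ℝ, 0 ≤ s → s ≤ 1 → 0 ≤ t → t ≤ 1 →
      -((t - s) * (h t - h s)) ≤ g t - g s) : g 0 ≤ g 1 := by
  have key : ∀ N : ℕ, g 0 - (h 1 - h 0) * (1 / ((N : ℝ) + 1)) ≤ g 1 := by
    intro N
    have hN : (0 : ℝ) < (N : ℝ) + 1 := by positivity
    have ind : ∀ k : ℕ, k ≤ N + 1 → g 0 - (h (k / ((N : ℝ) + 1)) - h 0) * (1 / ((N : ℝ) + 1)) ≤
        g (k / ((N : ℝ) + 1)) := by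
      intro k
      induction k with
      | zero => simp
      | succ k ih =>
        intro hk
        have hk' : (k : ℝ) + 1 ≤ (N : ℝ) + 1 := by exact_mod_cast hk
        have hstep := H (k / ((N : ℝ) + 1)) ((k + 1 : ℕ) / ((N : ℝ) + 1)) (by positivity)
          ((div_le_one hN).2 (by linarith)) (by positivity)
          ((div_le_one hN).2 (by push_cast; exact hk'))
        have hdiff : ((k + 1 : ℕ) : ℝ) / ((N : ℝ) + 1) - k / ((N : ℝ) + 1) =
            1 / ((N : ℝ) + 1) := by
          push_cast; ring
        rw [hdiff] at hstep
        have := ih (by omega)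
        nlinarith
    have := ind (N + 1) le_rfl
    push_cast at this
    rwa [div_self hN.ne'] at this
  have hlim : Filter.Tendsto (fun N : ℕ => g 0 - (h 1 - h 0) * (1 / ((N : ℝ) + 1)))
      Filter.atTop (nhds (g 0)) := by
    simpa using
      (tendsto_one_div_add_atTop_nhds_zero_nat (𝕜 := ℝ)).const_mul (h 1 - h 0) |>.const_sub (g 0)
  exact le_of_tendsto' hlim key

/-- for a continuous SW-Max training rule, any non-negative payment
rule implementing it in DSIC is pointwise at least the affine maximizer payment. -/
theorem nonneg_dsic_payment_ge_pAFF
    [Fintype X] [Nonempty X] {n : ℕ} (wbar : ℕ) (hwbar : 1 ≤ wbar)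
    (f : ℝ → ℝ) (hconv : ConvexOn ℝ (Set.Ioi 0) f) (hf1 : f 1 = 0)
    (Rdom : (X → ℝ) → Prop)
    (hdom : Rdom = (IsRewardSum (X := X)) ∨ Rdom = (IsRewardMax (X := X)))
    (ψ : (Fin n → X → ℝ) → (Fin n → ℕ) → (X → ℝ) → (X → ℝ))
    (hψ : SWMaxRule f Rdom ψ)
    (hcont : ContinuousRule ψ)
    (p : (Fin n → X → ℝ) → (Fin n → ℕ) → (X → ℝ) → Fin n → ℝ)
    (hp : DSICw Rdom wbar ψ p)
    (hnn : ∀ (r : Fin n → X → ℝ) (w : Fin n → ℕ) (i : Fin n) (π₀ : X → ℝ),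
      (∀ j, Rdom (r j)) → (∀ j, 1 ≤ w j ∧ w j ≤ wbar) →
      IsModel π₀ → FullSupport π₀ → 0 ≤ p r w π₀ i) :
    ∀ (i : Fin n) (r : Fin n → X → ℝ) (w : Fin n → ℕ) (π₀ : X → ℝ),
      (∀ j, Rdom (r j)) → (∀ j, 1 ≤ w j ∧ w j ≤ wbar) →
      IsModel π₀ → FullSupport π₀ →
      p r w π₀ i ≥ pAFF f ψ r w π₀ i := by
  intro i r w π₀ hr hw hm hs
  obtain ⟨c, hc⟩ := exists_const_reward_segment hdom
  set d : X → ℝ := r i - fun _ => c with hd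
  set q : ℝ → X → ℝ := fun t => (fun _ => c) + t • d with hq
  set ρ : ℝ → Fin n → X → ℝ := fun t => Function.update r i (q t) with hρ
  have hdomρ : ∀ t : ℝ, 0 ≤ t → t ≤ 1 → ∀ j, Rdom (ρ t j) := by
    intro t ht₀ ht₁ j
    by_cases hj : j = i
    · subst hj
      simpa [hρ] using hc _ (hr j) t ht₀ ht₁
    · simpa [hρ, hj] using hr j
  have hρ₀ : ρ 0 = Function.update r i (fun _ => c) := by simp [hρ, hq]
  have hρ₁ : ρ 1 = r := by simp [hρ, hq, hd]
  have mono := le_of_increment_ge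
    (g := fun t => p (ρ t) w π₀ i + ASWminus f r w i (ψ (ρ t) w π₀) π₀)
    (h := fun t => (w i : ℝ) * valuation (ψ (ρ t) w π₀) d) (by
      intro s t hs₀ hs₁ ht₀ ht₁
      have hdsic := hp (ρ s) w i (q t) (w i) π₀ (hdomρ s hs₀ hs₁) hw
        (hc _ (hr i) t ht₀ ht₁) (hw i).1 (hw i).2 hm hs
      have hρi : ρ s i = q s := by simp [hρ]
      have hρt : Function.update (ρ s) i (q t) = ρ t := by simp [hρ]
      rw [Function.update_eq_self, hρt, hρi] at hdsic
      have hmax := (hψ (ρ t) w π₀ (hdomρ t ht₀ ht₁) hm hs).2 _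
        (hψ (ρ s) w π₀ (hdomρ s hs₀ hs₁) hm hs).1
      simp only [hρ, ASW_update] at hmax
      simp only [hq, valuation_add_smul] at hdsic hmax
      rw [(hψ (ρ s) w π₀ (hdomρ s hs₀ hs₁) hm hs).1.valuation_const,
        (hψ (ρ t) w π₀ (hdomρ t ht₀ ht₁) hm hs).1.valuation_const] at hdsic
      have hms := (hψ (ρ s) w π₀ (hdomρ s hs₀ hs₁) hm hs).1.valuation_const c
      have hmt := (hψ (ρ t) w π₀ (hdomρ t ht₀ ht₁) hm hs).1.valuation_const c
      simp only [hρ, hq] at hms hmt hdsic ⊢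
      rw [hms, hmt] at hmax
      linarith)
  simp only [hρ₁] at mono
  have hpay := hnn (ρ 0) w i π₀ (hdomρ 0 le_rfl zero_le_one) hw hm hs
  have hψ₀ := hψ (ρ 0) w π₀ (hdomρ 0 le_rfl zero_le_one) hm hs
  have hremoved := (hψ r (Function.update w i 0) π₀ hr hm hs).1
  have hbest := hψ₀.2 _ hremoved
  rw [hρ₀] at hbest hψ₀
  rw [ASW_update, ASW_update, hremoved.valuation_const, hψ₀.1.valuation_const, ← hρ₀] at hbest
  simp only [pAFF]
  linarith
end
end
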